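/- (Theorem 4.1) Let δ ≥ 0 and assume σ̂_δ > 0. Then q̂_δ ∈ M(μ,σ), and for every q ∈ M(μ,σ) one has J_δ(q) ≤ μ − δ(ε_min + 2σσ_F) + σσ̂_δ, with equality if and only if q = q̂_δ almost everywhere; hence sup_{q ∈ M(μ,σ)} J_δ(q) = μ − δ(ε_min + 2σσ_F) + σσ̂_δ, attained uniquely (up to a.e. equality) at q̂_δ. -/

import Mathlib

open MeasureTheory Set Filter

noncomputable section

/-- Integral over the interval (0,1) with Lebesgue measure. -/
def intI (f : ℝ → ℝ) : ℝ := ∫ u in Ioo (0:ℝ) 1, f u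

/-- Square integrability on (0,1). -/
def SqInt (f : ℝ → ℝ) : Prop :=
  IntegrableOn f (Ioo (0:ℝ) 1) volume ∧ IntegrableOn (fun u => f u ^ 2) (Ioo (0:ℝ) 1) volume

/-- A quantile function: nondecreasing and square-integrable on (0,1). -/
def IsQuantile (q : ℝ → ℝ) : Prop := MonotoneOn q (Ioo (0:ℝ) 1) ∧ SqInt q

/-- Membership in `M(μ,σ)` : quantile function with prescribed first two moments. -/
def MemM (μ σ : ℝ) (q : ℝ → ℝ) : Prop :=
  IsQuantile q ∧ intI q = μ ∧ intI (fun u => q u ^ 2) = μ ^ 2 + σ ^ 2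

/-- Squared Wasserstein distance between (quantile) functions on (0,1). -/
def W2 (p q : ℝ → ℝ) : ℝ := intI (fun u => (p u - q u) ^ 2)

/-- Almost-everywhere equality on (0,1). -/
def AeEqI (f g : ℝ → ℝ) : Prop := f =ᵐ[(volume : Measure ℝ).restrict (Ioo (0:ℝ) 1)] g

/-- The penalized objective `J_δ(q) = ∫ γ q − δ d²(q_F, q)`. -/
def Jpen (γ qF : ℝ → ℝ) (δ : ℝ) (q : ℝ → ℝ) : ℝ :=
  intI (fun u => γ u * q u) - δ * W2 qF q

/-- `r` is the isotonic projection of `x` : it is nondecreasing, square-integrable, and satisfies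
the variational inequality characterizing the metric projection onto the cone of
nondecreasing square-integrable functions on (0,1). -/
def IsIsoProj (x r : ℝ → ℝ) : Prop :=
  MonotoneOn r (Ioo (0:ℝ) 1) ∧ SqInt r ∧
  ∀ s : ℝ → ℝ, MonotoneOn s (Ioo (0:ℝ) 1) → SqInt s →
    intI (fun u => (x u - r u) * (s u - r u)) ≤ 0

/-- `μ̂ = ∫ r`. -/
def muHat (r : ℝ → ℝ) : ℝ := intI r

/-- `σ̂ = sqrt(∫ r² − (∫ r)²)`. -/
def sigHat (r : ℝ → ℝ) : ℝ := Real.sqrt (intI (fun u => r u ^ 2) - muHat r ^ 2)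

/-- `q̂(u) = μ − (σ/σ̂) μ̂ + (σ/σ̂) r(u)`. -/
def qHat (μ σ : ℝ) (r : ℝ → ℝ) : ℝ → ℝ := fun u =>
  μ - σ / sigHat r * muHat r + σ / sigHat r * r u

theorem SqInt.memLp {f : ℝ → ℝ} (hf : SqInt f) :
    MemLp f 2 ((volume : Measure ℝ).restrict (Ioo (0:ℝ) 1)) :=
  (memLp_two_iff_integrable_sq hf.1.aestronglyMeasurable).2 hf.2

theorem MeasureTheory.MemLp.sqInt {f : ℝ → ℝ}
    (hf : MemLp f 2 ((volume : Measure ℝ).restrict (Ioo (0:ℝ) 1))) : SqInt f :=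
  ⟨hf.integrable one_le_two, hf.integrable_sq⟩

theorem SqInt.add {f g : ℝ → ℝ} (hf : SqInt f) (hg : SqInt g) : SqInt (fun u => f u + g u) :=
  (hf.memLp.add hg.memLp).sqInt

theorem SqInt.sub {f g : ℝ → ℝ} (hf : SqInt f) (hg : SqInt g) : SqInt (fun u => f u - g u) :=
  (hf.memLp.sub hg.memLp).sqInt

theorem SqInt.const_mul {f : ℝ → ℝ} (hf : SqInt f) (c : ℝ) : SqInt (fun u => c * f u) :=
  (hf.memLp.const_mul c).sqInt

theorem sqInt_const (c : ℝ) : SqInt (fun _ => c) := (memLp_const c).sqInt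

theorem SqInt.integrableOn_mul {f g : ℝ → ℝ} (hf : SqInt f) (hg : SqInt g) :
    IntegrableOn (fun u => f u * g u) (Ioo (0:ℝ) 1) volume :=
  hf.memLp.integrable_mul hg.memLp

theorem intI_add {f g : ℝ → ℝ} (hf : IntegrableOn f (Ioo (0:ℝ) 1))
    (hg : IntegrableOn g (Ioo (0:ℝ) 1)) : intI (fun u => f u + g u) = intI f + intI g :=
  integral_add hf hg

theorem intI_sub {f g : ℝ → ℝ} (hf : IntegrableOn f (Ioo (0:ℝ) 1))
    (hg : IntegrableOn g (Ioo (0:ℝ) 1)) : intI (fun u => f u - g u) = intI f - intI g :=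
  integral_sub hf hg

theorem intI_const_mul (c : ℝ) (f : ℝ → ℝ) : intI (fun u => c * f u) = c * intI f :=
  integral_const_mul c f

theorem intI_const (c : ℝ) : intI (fun _ => c) = c := by simp [intI]

theorem intI_sq_sub {f g : ℝ → ℝ} (hf : SqInt f) (hg : SqInt g) :
    intI (fun u => (f u - g u) ^ 2) =
      intI (fun u => f u ^ 2) - 2 * intI (fun u => f u * g u) + intI (fun u => g u ^ 2) := by
  have hfg := (hf.integrableOn_mul hg).const_mul 2
  rw [← intI_const_mul, ← intI_sub hf.2 hfg,
    ← intI_add (f := fun u => f u ^ 2 - 2 * (f u * g u)) (hf.2.sub hfg) hg.2]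
  congr 1
  funext u
  ring

/-- Integral of the product with an affine transform. -/
theorem intI_mul_affine {f g : ℝ → ℝ} (hf : SqInt f) (hg : SqInt g) (a b : ℝ) :
    intI (fun u => f u * (a + b * g u)) = a * intI f + b * intI (fun u => f u * g u) := by
  rw [← intI_const_mul, ← intI_const_mul,
    ← intI_add (hf.1.const_mul a) ((hf.integrableOn_mul hg).const_mul b)]
  congr 1
  funext u
  ring

theorem intI_sub_mul {f g h : ℝ → ℝ} (hf : SqInt f) (hg : SqInt g) (hh : SqInt h) :
    intI (fun u => (f u - g u) * h u) =
      intI (fun u => f u * h u) - intI (fun u => g u * h u) := by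
  rw [← intI_sub (hf.integrableOn_mul hh) (hg.integrableOn_mul hh)]
  congr 1
  funext u
  ring

theorem intI_sq_sub_eq_zero_iff {f g : ℝ → ℝ} (hf : SqInt f) (hg : SqInt g) :
    intI (fun u => (f u - g u) ^ 2) = 0 ↔ AeEqI f g := by
  rw [intI, integral_eq_zero_iff_of_nonneg (fun u => sq_nonneg _) (hf.sub hg).2]
  refine eventually_congr (Eventually.of_forall fun u => ?_)
  simp [sub_eq_zero]

namespace IsIsoProj

variable {x r : ℝ → ℝ}

theorem intI_residual_mul_nonpos (hr : IsIsoProj x r) {q : ℝ → ℝ} (hq : IsQuantile q) :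
    intI (fun u => (x u - r u) * q u) ≤ 0 := by
  have h := hr.2.2 (fun u => q u + r u) (hq.1.add hr.1) (hq.2.add hr.2.1)
  simpa using h

theorem intI_residual (hr : IsIsoProj x r) : intI (fun u => x u - r u) = 0 := by
  have h1 := hr.intI_residual_mul_nonpos (q := fun _ => 1) ⟨monotoneOn_const, sqInt_const 1⟩
  have h2 := hr.intI_residual_mul_nonpos (q := fun _ => -1) ⟨monotoneOn_const, sqInt_const (-1)⟩
  simp only [mul_one] at h1
  have h3 : intI (fun u => (x u - r u) * -1) = -intI (fun u => x u - r u) := by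
    rw [← neg_one_mul (intI _), ← intI_const_mul]
    simp
  linarith

theorem intI_residual_mul_self (hr : IsIsoProj x r) :
    intI (fun u => (x u - r u) * r u) = 0 := by
  have h1 := hr.intI_residual_mul_nonpos ⟨hr.1, hr.2.1⟩
  have h2 := hr.2.2 (fun _ => 0) monotoneOn_const (sqInt_const 0)
  have h3 : intI (fun u => (x u - r u) * (0 - r u)) = -intI (fun u => (x u - r u) * r u) := by
    rw [← neg_one_mul (intI _), ← intI_const_mul]
    simp
  linarith

end IsIsoProj

theorem qHat_eq (μ σ : ℝ) (r : ℝ → ℝ) :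
    qHat μ σ r = fun u => (μ - σ / sigHat r * muHat r) + σ / sigHat r * r u := rfl

theorem sigHat_sq {r : ℝ → ℝ} (h : 0 < sigHat r) :
    sigHat r ^ 2 = intI (fun u => r u ^ 2) - muHat r ^ 2 :=
  Real.sq_sqrt (Real.sqrt_pos.1 h).le

theorem memM_qHat {σ : ℝ} (μ : ℝ) {r : ℝ → ℝ} (hσ : 0 < σ) (hr : IsQuantile r)
    (h : 0 < sigHat r) : MemM μ σ (qHat μ σ r) := by
  have hb : 0 ≤ σ / sigHat r := by positivity
  have hsq : SqInt (qHat μ σ r) := (sqInt_const _).add (hr.2.const_mul _)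
  have hm : intI (qHat μ σ r) = μ := by
    rw [qHat_eq, intI_add (sqInt_const _).1 (hr.2.const_mul _).1, intI_const, intI_const_mul,
      muHat]
    ring
  refine ⟨⟨fun a ha b hb' hab => ?_, hsq⟩, hm, ?_⟩
  · have := mul_le_mul_of_nonneg_left (hr.1 ha hb' hab) hb
    simp only [qHat]
    linarith
  · have hrq : intI (fun u => r u * qHat μ σ r u) =
        (μ - σ / sigHat r * muHat r) * muHat r + σ / sigHat r * intI (fun u => r u ^ 2) := by
      simp only [qHat_eq, intI_mul_affine hr.2 hr.2, muHat, sq]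
    have hqq : intI (fun u => qHat μ σ r u ^ 2) = (μ - σ / sigHat r * muHat r) * μ +
        σ / sigHat r * intI (fun u => r u * qHat μ σ r u) := by
      have := intI_mul_affine hsq hr.2 (μ - σ / sigHat r * muHat r) (σ / sigHat r)
      rw [hm] at this
      simp only [sq, mul_comm (r _)]
      exact this
    rw [hqq, hrq, show intI (fun u => r u ^ 2) = sigHat r ^ 2 + muHat r ^ 2 by
      rw [sigHat_sq h]; ring]
    field_simp
    ring

/-- Among functions with the moments `μ, σ`, the correlation with `r` falls short of its
Cauchy–Schwarz bound by a multiple of the squared distance to `qHat μ σ r`. -/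
theorem intI_mul_eq_of_memM {μ σ : ℝ} {r q : ℝ → ℝ} (hσ : 0 < σ) (hr : IsQuantile r)
    (h : 0 < sigHat r) (hq : MemM μ σ q) :
    intI (fun u => r u * q u) = muHat r * μ + σ * sigHat r -
      sigHat r / (2 * σ) * intI (fun u => (q u - qHat μ σ r u) ^ 2) := by
  have hM := memM_qHat μ hσ hr h
  rw [intI_sq_sub hq.1.2 hM.1.2, hq.2.2, hM.2.2]
  simp only [qHat_eq, intI_mul_affine hq.1.2 hr.2, hq.2.1, mul_comm (r _)]
  field_simp
  ring

theorem Jpen_eq {γ qF q : ℝ → ℝ} (hγ : SqInt γ) (hqF : SqInt qF) (hq : SqInt q) (δ : ℝ) :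
    Jpen γ qF δ q = intI (fun u => (γ u + 2 * δ * qF u) * q u) -
      δ * (intI (fun u => qF u ^ 2) + intI (fun u => q u ^ 2)) := by
  have h : intI (fun u => (γ u + 2 * δ * qF u) * q u) =
      intI (fun u => γ u * q u) + 2 * δ * intI (fun u => qF u * q u) := by
    rw [← intI_const_mul,
      ← intI_add (hγ.integrableOn_mul hq) ((hqF.integrableOn_mul hq).const_mul (2 * δ))]
    congr 1
    funext u
    ring
  rw [Jpen, W2, intI_sq_sub hqF hq, h]
  ring

theorem statement14
    (μ μF σ σF : ℝ) (hσpos : 0 < σ) (hσFpos : 0 < σF)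
    (qF : ℝ → ℝ) (hqF : IsQuantile qF)
    (hqFm : intI qF = μF) (hqF2 : intI (fun u => qF u ^ 2) = μF ^ 2 + σF ^ 2)
    (γ : ℝ → ℝ) (hγsq : SqInt γ) (hγ1 : intI γ = 1)
    (εmin : ℝ) (hεmin : εmin = (μF - μ) ^ 2 + (σF - σ) ^ 2)
    (δ : ℝ) (hδ : 0 ≤ δ)
    (r : ℝ → ℝ) (hr : IsIsoProj (fun u => γ u + 2 * δ * qF u) r)
    (hσhat : 0 < sigHat r) :
    MemM μ σ (qHat μ σ r) ∧
    ∀ q : ℝ → ℝ, MemM μ σ q →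
      Jpen γ qF δ q ≤ μ - δ * (εmin + 2 * σ * σF) + σ * sigHat r ∧
      (Jpen γ qF δ q = μ - δ * (εmin + 2 * σ * σF) + σ * sigHat r ↔
        AeEqI q (qHat μ σ r)) := by
  have hx : SqInt (fun u => γ u + 2 * δ * qF u) := hγsq.add (hqF.2.const_mul _)
  have hrq : IsQuantile r := ⟨hr.1, hr.2.1⟩
  have hM := memM_qHat μ hσpos hrq hσhat
  have hmu : muHat r = 1 + 2 * δ * μF := by
    have h1 := hr.intI_residual
    rw [intI_sub hx.1 hrq.2.1, intI_add hγsq.1 (hqF.2.const_mul _).1, intI_const_mul, hγ1,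
      hqFm] at h1
    rw [muHat]
    linarith
  have hJ : ∀ q, MemM μ σ q → Jpen γ qF δ q = μ - δ * (εmin + 2 * σ * σF) + σ * sigHat r +
      intI (fun u => (γ u + 2 * δ * qF u - r u) * q u) -
      sigHat r / (2 * σ) * intI (fun u => (q u - qHat μ σ r u) ^ 2) := by
    intro q hq
    have h1 := intI_mul_eq_of_memM hσpos hrq hσhat hq
    rw [Jpen_eq hγsq hqF.2 hq.1.2, hqF2, hq.2.2, intI_sub_mul hx hrq.2 hq.1.2, h1, hmu, hεmin]
    ring
  have hc : 0 < sigHat r / (2 * σ) := by positivity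
  refine ⟨hM, fun q hq => ?_⟩
  have hE := hr.intI_residual_mul_nonpos hq.1
  have hD : 0 ≤ intI (fun u => (q u - qHat μ σ r u) ^ 2) :=
    integral_nonneg fun u => sq_nonneg _
  have hcD := mul_nonneg hc.le hD
  have hJq := hJ q hq
  refine ⟨by linarith, fun heq => ?_, fun hae => ?_⟩
  · rw [← intI_sq_sub_eq_zero_iff hq.1.2 hM.1.2]
    have h0 : sigHat r / (2 * σ) * intI (fun u => (q u - qHat μ σ r u) ^ 2) = 0 := by linarith
    exact (mul_eq_zero.1 h0).resolve_left hc.ne'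
  · have hE0 : intI (fun u => (γ u + 2 * δ * qF u - r u) * q u) = 0 := by
      have hcongr : intI (fun u => (γ u + 2 * δ * qF u - r u) * q u) =
          intI (fun u => (γ u + 2 * δ * qF u - r u) * qHat μ σ r u) := by
        refine integral_congr_ae ?_
        filter_upwards [hae] with u hu
        rw [hu]
      rw [hcongr]
      simp only [qHat_eq]
      rw [intI_mul_affine (hx.sub hrq.2) hrq.2, hr.intI_residual, hr.intI_residual_mul_self]
      ring
    rw [hJq, hE0, (intI_sq_sub_eq_zero_iff hq.1.2 hM.1.2).2 hae]
    ring
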